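/- arXiv:1412.8257 — 2 statements merged into one kernel-verified Lean document; each statement's English description precedes it below -/
import Mathlib

section
/- Let n ≥ 0 be an integer and let f be holomorphic on ℍ with |f(τ)| ≤ C e^{−c Im τ} for some constants C, c > 0. Then the (n+1)-st holomorphic Wirtinger derivative in τ of the non-holomorphic Eichler integral vanishes identically: ∂_τ^{n+1} Ê_n(f) = 0 on ℍ; equivalently D^{n+1}( Ê_n(f) ) = 0. -/
open Complex MeasureTheory

noncomputable section

/-- Holomorphic Wirtinger derivative, as an operator on functions of `τ`. -/
def wderOp : (ℂ → ℂ) → (ℂ → ℂ) :=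
  fun f w => (fderiv ℝ f w 1 - Complex.I * fderiv ℝ f w Complex.I) / 2

/-- The operator `D = (1/(2πi)) ∂_τ`, as an operator on functions of `τ`. -/
def Dop : (ℂ → ℂ) → (ℂ → ℂ) :=
  fun f τ => wderOp f τ / (2 * (Real.pi : ℂ) * Complex.I)

/-- The non-holomorphic Eichler integral
`Ê_n(f)(τ) = conj(∫_τ^{i∞} f(t)(t−τ̄)^n dt)`, the integral taken along the
vertical ray `t = τ + is`, `s ∈ (0,∞)`. -/
def Ehat (n : ℕ) (f : ℂ → ℂ) (τ : ℂ) : ℂ :=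
  (starRingEnd ℂ)
    (∫ s in Set.Ioi (0:ℝ),
      f (τ + (s : ℂ) * Complex.I) *
        ((τ + (s : ℂ) * Complex.I) - (starRingEnd ℂ) τ) ^ n * Complex.I)

lemma wderOp_congr_of_eventuallyEq {g h : ℂ → ℂ} {w : ℂ} (e : g =ᶠ[nhds w] h) :
    wderOp g w = wderOp h w := by
  simp only [wderOp, e.fderiv_eq]

/-- A sum of products of antiholomorphic functions with monomials is differentiated by `∂_w`
as if the antiholomorphic factors were constant. -/
lemma wderOp_sum_conj_mul_pow (m : ℕ) (G : ℕ → ℂ → ℂ) (w : ℂ)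
    (hG : ∀ k, DifferentiableAt ℂ (G k) w) :
    wderOp (fun z => ∑ k ∈ Finset.range m, (starRingEnd ℂ) (G k z) * z ^ k) w =
      ∑ k ∈ Finset.range m, (starRingEnd ℂ) (G k w) * (k * w ^ (k - 1)) := by
  have hconj (k : ℕ) := (Complex.conjCLE : ℂ →L[ℝ] ℂ).hasFDerivAt.comp w
    ((hG k).hasDerivAt.hasFDerivAt.restrictScalars ℝ)
  have hpow (k : ℕ) := (hasDerivAt_pow k w).hasFDerivAt.restrictScalars ℝ
  have hsum := HasFDerivAt.fun_sum (u := Finset.range m) fun k _ => (hconj k).mul (hpow k)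
  have hfd : fderiv ℝ (fun z => ∑ k ∈ Finset.range m, (starRingEnd ℂ) (G k z) * z ^ k) w = _ :=
    hsum.fderiv
  rw [wderOp, hfd]
  simp only [_root_.sum_apply, Finset.mul_sum, ← Finset.sum_sub_distrib,
    Finset.sum_div]
  refine Finset.sum_congr rfl fun k _ => ?_
  simp
  ring_nf
  simp only [Complex.I_sq]
  ring

lemma iterate_wderOp_sum_conj_mul_pow (c : ℂ) (m : ℕ) (G : ℕ → ℂ → ℂ) (g : ℂ → ℂ)
    {U : Set ℂ} (hU : IsOpen U) (hG : ∀ k, DifferentiableOn ℂ (G k) U)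
    (hg : ∀ z ∈ U, g z = ∑ k ∈ Finset.range m, (starRingEnd ℂ) (G k z) * z ^ k) :
    ∀ w ∈ U, (fun (h : ℂ → ℂ) z => c * wderOp h z)^[m] g w = 0 := by
  induction m generalizing G g with
  | zero => simpa using hg
  | succ m ih =>
    rw [Function.iterate_succ]
    refine ih (fun k z => (starRingEnd ℂ) c * (k + 1) * G (k + 1) z) _
      (fun k => (hG (k + 1)).const_mul _) fun z hz => ?_
    have e : g =ᶠ[nhds z]
        fun z => ∑ k ∈ Finset.range (m + 1), (starRingEnd ℂ) (G k z) * z ^ k := by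
      filter_upwards [hU.mem_nhds hz] using hg
    beta_reduce
    rw [wderOp_congr_of_eventuallyEq e,
      wderOp_sum_conj_mul_pow _ _ _ fun k => (hG k).differentiableAt (hU.mem_nhds hz),
      Finset.sum_range_succ']
    simp only [Nat.cast_zero, zero_mul, mul_zero, add_zero, Finset.mul_sum]
    refine Finset.sum_congr rfl fun k _ => ?_
    simp
    ring

lemma continuousOn_vertical_ray {h : ℂ → ℂ} (hh : ContinuousOn h {z : ℂ | 0 < z.im})
    {w : ℂ} (hw : 0 < w.im) :
    ContinuousOn (fun s : ℝ => h (w + (s : ℂ) * I)) (Set.Ioi 0) := by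
  refine hh.comp (by fun_prop) fun s hs => ?_
  have : 0 < s := hs
  simp
  linarith

lemma integrableOn_vertical_ray {h : ℂ → ℂ} (hh : ContinuousOn h {z : ℂ | 0 < z.im})
    {C b : ℝ} (hb : 0 < b)
    (hbound : ∀ z : ℂ, 0 < z.im →
      ‖h z‖ ≤ C * (Real.exp (b * |z.re|) * Real.exp (-b * z.im)))
    {w : ℂ} (hw : 0 < w.im) :
    IntegrableOn (fun s : ℝ => h (w + (s : ℂ) * I)) (Set.Ioi 0) := by
  refine Integrable.mono'
    ((exp_neg_integrableOn_Ioi 0 hb).const_mul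
      (C * (Real.exp (b * |w.re|) * Real.exp (-b * w.im))))
    ((continuousOn_vertical_ray hh hw).aestronglyMeasurable measurableSet_Ioi) ?_
  refine (ae_restrict_iff' measurableSet_Ioi).2 (Filter.Eventually.of_forall fun s hs => ?_)
  have hs' : 0 < s := hs
  refine (hbound _ (by simp; linarith)).trans_eq ?_
  simp [mul_add, Real.exp_add, mul_assoc]

/-- Integrating a holomorphic function of controlled growth along vertical rays gives a
holomorphic function of the starting point. -/
lemma differentiableOn_integral_vertical_ray {h : ℂ → ℂ}
    (hh : DifferentiableOn ℂ h {z : ℂ | 0 < z.im})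
    {C b : ℝ} (hC : 0 ≤ C) (hb : 0 < b)
    (hbound : ∀ z : ℂ, 0 < z.im →
      ‖h z‖ ≤ C * (Real.exp (b * |z.re|) * Real.exp (-b * z.im))) :
    DifferentiableOn ℂ (fun w => ∫ s in Set.Ioi (0 : ℝ), h (w + (s : ℂ) * I))
      {z : ℂ | 0 < z.im} := by
  intro w hw
  have hU : IsOpen {z : ℂ | 0 < z.im} := isOpen_lt continuous_const Complex.continuous_im
  have hw' : 0 < w.im := hw
  set r := w.im / 3 with hr
  have hr0 : 0 < r := by positivity
  have him {z : ℂ} (hz : z ∈ Metric.ball w r) : w.im - r < z.im ∧ |z.re| < |w.re| + r := by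
    rw [Metric.mem_ball, dist_eq_norm] at hz
    have h1 := (Complex.abs_im_le_norm (z - w)).trans_lt hz
    have h2 := (Complex.abs_re_le_norm (z - w)).trans_lt hz
    rw [Complex.sub_im, abs_lt] at h1
    rw [Complex.sub_re] at h2
    have h3 := abs_sub_abs_le_abs_sub z.re w.re
    constructor <;> linarith
  have hpos {z : ℂ} (hz : z ∈ Metric.ball w r) : 0 < z.im := by
    have := (him hz).1
    linarith
  have hray {z : ℂ} (hz : 0 < z.im) {s : ℝ} (hs : 0 < s) : 0 < (z + (s : ℂ) * I).im := by
    simp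
    linarith
  refine (hasDerivAt_integral_of_dominated_loc_of_deriv_le
    (F := fun z (s : ℝ) => h (z + (s : ℂ) * I))
    (F' := fun z (s : ℝ) => deriv h (z + (s : ℂ) * I))
    (bound := fun s => C * Real.exp (b * (|w.re| + 2 * r)) / r * Real.exp (-b * s))
    (Metric.ball_mem_nhds w hr0) ?_
    (integrableOn_vertical_ray hh.continuousOn hb hbound hw) ?_ ?_
    ((exp_neg_integrableOn_Ioi 0 hb).const_mul _) ?_).2.differentiableAt.differentiableWithinAt
  · filter_upwards [hU.mem_nhds hw] with z hz
    exact (continuousOn_vertical_ray hh.continuousOn hz).aestronglyMeasurable measurableSet_Ioi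
  · exact (continuousOn_vertical_ray (hh.deriv hU).continuousOn hw).aestronglyMeasurable
      measurableSet_Ioi
  · refine (ae_restrict_iff' measurableSet_Ioi).2
      (Filter.Eventually.of_forall fun s hs z hz => ?_)
    have hs' : 0 < s := hs
    have hball {u : ℂ} (hu : u ∈ Metric.closedBall (z + (s : ℂ) * I) r) :
        s < u.im ∧ |u.re| ≤ |w.re| + 2 * r := by
      rw [Metric.mem_closedBall, dist_eq_norm] at hu
      have h1 := (Complex.abs_im_le_norm _).trans hu
      have h2 := (Complex.abs_re_le_norm _).trans hu
      simp only [sub_im, add_im, mul_im, ofReal_re, I_im, mul_one, ofReal_im, I_re, mul_zero,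
        add_zero, abs_le] at h1
      simp only [sub_re, add_re, mul_re, ofReal_re, I_im, mul_one, ofReal_im, I_re, mul_zero,
        sub_self, add_zero] at h2
      have h3 := abs_sub_abs_le_abs_sub u.re z.re
      have h4 := him hz
      constructor <;> linarith
    refine (norm_deriv_le_of_forall_mem_sphere_norm_le
      (C := C * (Real.exp (b * (|w.re| + 2 * r)) * Real.exp (-b * s))) hr0 ?_ ?_).trans_eq
        (by ring)
    · refine (hh.mono fun u hu => ?_).diffContOnCl_ball subset_rfl
      exact hs'.trans (hball hu).1
    · intro u hu
      obtain ⟨h1, h2⟩ := hball (Metric.sphere_subset_closedBall hu)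
      refine (hbound u (hs'.trans h1)).trans ?_
      have h3 : -b * u.im ≤ -b * s := by nlinarith
      gcongr
  · refine (ae_restrict_iff' measurableSet_Ioi).2
      (Filter.Eventually.of_forall fun s hs z hz => ?_)
    exact (hh.differentiableAt (hU.mem_nhds (hray (hpos hz) hs))).hasDerivAt.comp_add_const z _

lemma norm_mul_pow_le_of_exp_decay {f : ℂ → ℂ} {C c : ℝ} (hC : 0 < C) (hc : 0 < c)
    (hf : ∀ z : ℂ, 0 < z.im → ‖f z‖ ≤ C * Real.exp (-c * z.im)) (k : ℕ) (z : ℂ)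
    (hz : 0 < z.im) :
    ‖f z * z ^ k‖ ≤ C * (k.factorial / (c / 2) ^ k) *
      (Real.exp (c / 2 * |z.re|) * Real.exp (-(c / 2) * z.im)) := by
  have h1 : ‖z‖ ^ k ≤ k.factorial / (c / 2) ^ k * Real.exp (c / 2 * ‖z‖) := by
    have := Real.pow_div_factorial_le_exp (c / 2 * ‖z‖) (by positivity) k
    rw [mul_pow, div_le_iff₀ (by positivity)] at this
    rw [div_mul_eq_mul_div, le_div_iff₀ (by positivity)]
    linarith
  have h2 : ‖z‖ ≤ |z.re| + z.im := by
    simpa [abs_of_pos hz] using Complex.norm_le_abs_re_add_abs_im z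
  rw [norm_mul, norm_pow]
  calc ‖f z‖ * ‖z‖ ^ k
      ≤ (C * Real.exp (-c * z.im)) *
        (k.factorial / (c / 2) ^ k * Real.exp (c / 2 * (|z.re| + z.im))) := by
        refine mul_le_mul (hf z hz) (h1.trans ?_) (by positivity) (by positivity)
        gcongr
    _ = C * (k.factorial / (c / 2) ^ k) *
        (Real.exp (-c * z.im) * Real.exp (c / 2 * (|z.re| + z.im))) := by ring
    _ = _ := by
        rw [← Real.exp_add, ← Real.exp_add]
        ring_nf

/-- The Eichler integral as a polynomial in `z` with antiholomorphic coefficients. -/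
lemma Ehat_eq_sum_conj_mul_pow (n : ℕ) (f : ℂ → ℂ) (z : ℂ)
    (hint : ∀ k, IntegrableOn
      (fun s : ℝ => f (z + (s : ℂ) * I) * (z + (s : ℂ) * I) ^ k) (Set.Ioi 0)) :
    Ehat n f z = ∑ k ∈ Finset.range (n + 1), (starRingEnd ℂ)
      (((-1) ^ k * n.choose k * I) * ∫ s in Set.Ioi (0 : ℝ),
        f (z + (s : ℂ) * I) * (z + (s : ℂ) * I) ^ (n - k)) * z ^ k := by
  have expand (s : ℝ) : f (z + (s : ℂ) * I) *
        ((z + (s : ℂ) * I) - (starRingEnd ℂ) z) ^ n * I =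
      ∑ k ∈ Finset.range (n + 1), ((-1) ^ k * n.choose k * I * (starRingEnd ℂ) z ^ k) *
        (f (z + (s : ℂ) * I) * (z + (s : ℂ) * I) ^ (n - k)) := by
    rw [sub_eq_neg_add, add_pow, Finset.mul_sum, Finset.sum_mul]
    refine Finset.sum_congr rfl fun k _ => ?_
    rw [neg_pow]
    ring
  simp only [Ehat, expand]
  rw [integral_finsetSum _ fun k _ => (hint (n - k)).const_mul _, map_sum]
  refine Finset.sum_congr rfl fun k _ => ?_
  rw [integral_const_mul]
  simp only [map_mul, map_pow, Complex.conj_conj]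
  ring

/-- for `f` holomorphic on `ℍ` with exponential decay, the
`(n+1)`-st holomorphic Wirtinger derivative of `Ê_n(f)` vanishes on `ℍ`:
`∂_τ^{n+1} Ê_n(f) = 0`, equivalently `D^{n+1}(Ê_n(f)) = 0`. -/
theorem Ehat_bol_vanishing (n : ℕ) (f : ℂ → ℂ)
    (hf : DifferentiableOn ℂ f {τ : ℂ | 0 < τ.im})
    (hdecay : ∃ C c : ℝ, 0 < C ∧ 0 < c ∧
      ∀ τ : ℂ, 0 < τ.im → ‖f τ‖ ≤ C * Real.exp (-c * τ.im))
    (τ : ℂ) (hτ : 0 < τ.im) :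
    wderOp^[n + 1] (Ehat n f) τ = 0 ∧ Dop^[n + 1] (Ehat n f) τ = 0 := by
  obtain ⟨C, c, hC, hc, hdecay⟩ := hdecay
  have hU : IsOpen {z : ℂ | 0 < z.im} := isOpen_lt continuous_const Complex.continuous_im
  have hdiff (k : ℕ) : DifferentiableOn ℂ (fun z => f z * z ^ k) {z : ℂ | 0 < z.im} :=
    hf.mul (by fun_prop)
  have hbound := norm_mul_pow_le_of_exp_decay hC hc hdecay
  have hvanish (a : ℂ) := iterate_wderOp_sum_conj_mul_pow a (n + 1)
    (fun k z => ((-1) ^ k * n.choose k * I) * ∫ s in Set.Ioi (0 : ℝ),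
      f (z + (s : ℂ) * I) * (z + (s : ℂ) * I) ^ (n - k)) (Ehat n f) hU
    (fun k => (differentiableOn_integral_vertical_ray (hdiff (n - k)) (by positivity)
      (half_pos hc) (hbound (n - k))).const_mul _)
    (fun z hz => Ehat_eq_sum_conj_mul_pow n f z fun k =>
      integrableOn_vertical_ray (hdiff k).continuousOn (half_pos hc) (hbound k) hz) τ hτ
  constructor
  · have e : wderOp = fun h z => 1 * wderOp h z := by simp
    rw [e]
    exact hvanish 1
  · have e : Dop = fun h z => (2 * (Real.pi : ℂ) * I)⁻¹ * wderOp h z := by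
      funext h z
      simp only [Dop, div_eq_inv_mul]
    rw [e]
    exact hvanish _
end
end

section
/- Let n ≥ 0 be an integer and let f be holomorphic on ℍ with |f(τ)| ≤ C e^{−c Im τ} for some constants C, c > 0. Then the holomorphic Eichler integral E_n(f) is holomorphic on ℍ and satisfies the Bol-type identity ∂_τ^{n+1} E_n(f)(τ) = (−1)^{n+1} n! · f(τ) for all τ ∈ ℍ; equivalently D^{n+1}( E_n(f) ) = ((−1)^{n+1} n! / (2πi)^{n+1}) · f. -/
open Complex MeasureTheory

noncomputable section

/-- The holomorphic Eichler integral
`E_n(f)(τ) = ∫_τ^{i∞} f(t)(t−τ)^n dt`, the integral taken along the vertical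
ray `t = τ + is`, `s ∈ (0,∞)` (so that `t − τ = is`). -/
def Eich (n : ℕ) (f : ℂ → ℂ) (τ : ℂ) : ℂ :=
  ∫ s in Set.Ioi (0:ℝ),
    f (τ + (s : ℂ) * Complex.I) * ((s : ℂ) * Complex.I) ^ n * Complex.I

theorem HasDerivAt.wderOp_eq {g : ℂ → ℂ} {g' w : ℂ} (h : HasDerivAt g g' w) :
    wderOp g w = g' := by
  have h1 : fderiv ℝ g w = (ContinuousLinearMap.toSpanSingleton ℂ g').restrictScalars ℝ :=
    (h.hasFDerivAt.restrictScalars ℝ).fderiv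
  simp only [wderOp, h1, ContinuousLinearMap.coe_restrictScalars',
    ContinuousLinearMap.toSpanSingleton_apply, smul_eq_mul, one_mul]
  rw [← mul_assoc, I_mul_I]
  ring

theorem wderOp_congr {g h : ℂ → ℂ} {w : ℂ} (hgh : g =ᶠ[nhds w] h) : wderOp g w = wderOp h w := by
  simp only [wderOp, hgh.fderiv_eq]

theorem wderOp_const_smul (a : ℂ) (g : ℂ → ℂ) : wderOp (a • g) = a • wderOp g := by
  funext w
  simp only [wderOp, fderiv_const_smul_field, Pi.smul_apply, _root_.smul_apply, smul_eq_mul]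
  ring

theorem Dop_eq_smul (g : ℂ → ℂ) : Dop g = (2 * (Real.pi : ℂ) * I)⁻¹ • wderOp g := by
  funext w
  simp only [Dop, Pi.smul_apply, smul_eq_mul, div_eq_inv_mul]

theorem Dop_iterate (k : ℕ) (g : ℂ → ℂ) :
    Dop^[k] g = ((2 * (Real.pi : ℂ) * I) ^ k)⁻¹ • wderOp^[k] g := by
  induction k with
  | zero => simp
  | succ k ih =>
    rw [Function.iterate_succ_apply', Function.iterate_succ_apply', ih, Dop_eq_smul,
      wderOp_const_smul, smul_smul, pow_succ', ← mul_inv]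

theorem add_ofReal_mul_I_im (τ : ℂ) (s : ℝ) : (τ + (s : ℂ) * I).im = τ.im + s := by simp

theorem integrableOn_pow_mul_exp_neg_mul (n : ℕ) {c : ℝ} (hc : 0 < c) :
    IntegrableOn (fun s : ℝ => s ^ n * Real.exp (-c * s)) (Set.Ioi 0) := by
  simpa using integrableOn_rpow_mul_exp_neg_mul_rpow (p := 1) (s := n) (b := c)
    (by linarith [n.cast_nonneg (α := ℝ)]) one_pos hc

theorem norm_Eich_integrand_le {g : ℂ → ℂ} {z : ℂ} {K c s : ℝ} (n : ℕ) (hs : 0 < s)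
    (hb : ‖g z‖ ≤ K * Real.exp (-c * s)) :
    ‖g z * ((s : ℂ) * I) ^ n * I‖ ≤ K * (s ^ n * Real.exp (-c * s)) := by
  have : ‖g z * ((s : ℂ) * I) ^ n * I‖ = ‖g z‖ * s ^ n := by
    simp [abs_of_pos hs]
  rw [this]
  calc ‖g z‖ * s ^ n ≤ K * Real.exp (-c * s) * s ^ n := by gcongr
    _ = _ := by ring

theorem continuousOn_Eich_integrand {g : ℂ → ℂ} (hg : ContinuousOn g {z : ℂ | 0 < z.im}) (n : ℕ)
    {τ : ℂ} (hτ : 0 < τ.im) :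
    ContinuousOn (fun s : ℝ => g (τ + (s : ℂ) * I) * ((s : ℂ) * I) ^ n * I) (Set.Ioi 0) := by
  have h : ContinuousOn (fun s : ℝ => g (τ + (s : ℂ) * I)) (Set.Ioi 0) := by
    refine hg.comp (by fun_prop) fun s hs => ?_
    rw [Set.mem_Ioi] at hs
    rw [Set.mem_ofPred_eq, add_ofReal_mul_I_im]
    linarith
  exact (h.mul (by fun_prop)).mul continuousOn_const

theorem integrableOn_Eich_integrand {g : ℂ → ℂ} (hg : ContinuousOn g {z : ℂ | 0 < z.im}) (n : ℕ)
    {τ : ℂ} (hτ : 0 < τ.im) {K c : ℝ} (hc : 0 < c)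
    (hb : ∀ s : ℝ, 0 < s → ‖g (τ + (s : ℂ) * I)‖ ≤ K * Real.exp (-c * s)) :
    IntegrableOn (fun s : ℝ => g (τ + (s : ℂ) * I) * ((s : ℂ) * I) ^ n * I) (Set.Ioi 0) := by
  refine Integrable.mono' ((integrableOn_pow_mul_exp_neg_mul n hc).const_mul K)
    ((continuousOn_Eich_integrand hg n hτ).aestronglyMeasurable measurableSet_Ioi) ?_
  filter_upwards [ae_restrict_mem measurableSet_Ioi] with s hs
  exact norm_Eich_integrand_le n hs (hb s hs)

section Decay

variable {f : ℂ → ℂ} {C c : ℝ}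

theorem norm_ray_le_of_decay (hC : 0 < C) (hc : 0 < c)
    (hdecay : ∀ τ : ℂ, 0 < τ.im → ‖f τ‖ ≤ C * Real.exp (-c * τ.im)) {z : ℂ} {s : ℝ}
    (hz : 0 < z.im) (hs : s ≤ z.im) : ‖f z‖ ≤ C * Real.exp (-c * s) := by
  refine (hdecay z hz).trans ?_
  gcongr C * Real.exp ?_
  nlinarith

/-- Cauchy's estimate: the derivative decays at the same rate, away from the real axis. -/
theorem norm_deriv_le_of_decay (hf : DifferentiableOn ℂ f {τ : ℂ | 0 < τ.im}) (hC : 0 < C)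
    (hc : 0 < c) (hdecay : ∀ τ : ℂ, 0 < τ.im → ‖f τ‖ ≤ C * Real.exp (-c * τ.im)) {z : ℂ}
    {s r : ℝ} (hr : 0 < r) (hs : 0 < s) (hz : r + s ≤ z.im) :
    ‖deriv f z‖ ≤ C / r * Real.exp (-c * s) := by
  have him : ∀ w ∈ Metric.closedBall z r, s ≤ w.im := by
    intro w hw
    have h1 : |(w - z).im| ≤ r := (abs_im_le_norm _).trans (mem_closedBall_iff_norm.1 hw)
    rw [sub_im, abs_le] at h1
    linarith
  have h := norm_deriv_le_of_forall_mem_sphere_norm_le (f := f) (c := z)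
    (C := C * Real.exp (-c * s)) hr ?_ ?_
  · rwa [div_mul_eq_mul_div]
  · refine DifferentiableOn.diffContOnCl (hf.mono fun w hw => ?_)
    exact hs.trans_le (him w (Metric.closure_ball_subset_closedBall hw))
  · intro w hw
    have := him w (Metric.sphere_subset_closedBall hw)
    exact norm_ray_le_of_decay hC hc hdecay (hs.trans_le this) this

theorem differentiableOn_deriv_upperHalfPlane
    (hf : DifferentiableOn ℂ f {τ : ℂ | 0 < τ.im}) :
    DifferentiableOn ℂ (deriv f) {τ : ℂ | 0 < τ.im} :=
  hf.deriv (isOpen_lt continuous_const continuous_im)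

theorem hasDerivAt_of_im_pos (hf : DifferentiableOn ℂ f {τ : ℂ | 0 < τ.im}) {z : ℂ}
    (hz : 0 < z.im) : HasDerivAt f (deriv f z) z :=
  (hf.differentiableAt ((isOpen_lt continuous_const continuous_im).mem_nhds hz)).hasDerivAt

theorem integrableOn_Eich_integrand_of_decay (hf : DifferentiableOn ℂ f {τ : ℂ | 0 < τ.im})
    (hC : 0 < C) (hc : 0 < c) (hdecay : ∀ τ : ℂ, 0 < τ.im → ‖f τ‖ ≤ C * Real.exp (-c * τ.im))
    (n : ℕ) {τ : ℂ} (hτ : 0 < τ.im) :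
    IntegrableOn (fun s : ℝ => f (τ + (s : ℂ) * I) * ((s : ℂ) * I) ^ n * I) (Set.Ioi 0) := by
  refine integrableOn_Eich_integrand (K := C) hf.continuousOn n hτ hc fun s hs => ?_
  apply norm_ray_le_of_decay hC hc hdecay <;> rw [add_ofReal_mul_I_im] <;> linarith

theorem integrableOn_Eich_integrand_deriv (hf : DifferentiableOn ℂ f {τ : ℂ | 0 < τ.im})
    (hC : 0 < C) (hc : 0 < c) (hdecay : ∀ τ : ℂ, 0 < τ.im → ‖f τ‖ ≤ C * Real.exp (-c * τ.im))
    (n : ℕ) {τ : ℂ} (hτ : 0 < τ.im) :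
    IntegrableOn (fun s : ℝ => deriv f (τ + (s : ℂ) * I) * ((s : ℂ) * I) ^ n * I)
      (Set.Ioi 0) := by
  refine integrableOn_Eich_integrand (K := C / τ.im)
    (differentiableOn_deriv_upperHalfPlane hf).continuousOn n hτ hc fun s hs => ?_
  refine norm_deriv_le_of_decay hf hC hc hdecay hτ hs ?_
  rw [add_ofReal_mul_I_im]

/-- Differentiation under the integral sign. -/
theorem hasDerivAt_Eich (hf : DifferentiableOn ℂ f {τ : ℂ | 0 < τ.im})
    (hC : 0 < C) (hc : 0 < c) (hdecay : ∀ τ : ℂ, 0 < τ.im → ‖f τ‖ ≤ C * Real.exp (-c * τ.im))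
    (n : ℕ) {τ : ℂ} (hτ : 0 < τ.im) :
    HasDerivAt (Eich n f) (Eich n (deriv f) τ) τ := by
  set r := τ.im / 2 with hr_def
  have hr : 0 < r := half_pos hτ
  have him : ∀ w ∈ Metric.ball τ r, r ≤ w.im := by
    intro w hw
    have h1 : |(w - τ).im| < r := (abs_im_le_norm _).trans_lt (mem_ball_iff_norm.1 hw)
    rw [sub_im, abs_lt] at h1
    linarith
  refine (hasDerivAt_integral_of_dominated_loc_of_deriv_le
    (μ := volume.restrict (Set.Ioi (0 : ℝ)))
    (F := fun z s => f (z + ((s : ℝ) : ℂ) * I) * ((s : ℂ) * I) ^ n * I)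
    (F' := fun z s => deriv f (z + ((s : ℝ) : ℂ) * I) * ((s : ℂ) * I) ^ n * I)
    (bound := fun s => C / r * (s ^ n * Real.exp (-c * s)))
    (Metric.ball_mem_nhds τ hr) ?_
    (integrableOn_Eich_integrand_of_decay hf hC hc hdecay n hτ)
    (integrableOn_Eich_integrand_deriv hf hC hc hdecay n hτ).aestronglyMeasurable ?_
    ((integrableOn_pow_mul_exp_neg_mul n hc).const_mul _) ?_).2
  · filter_upwards [Metric.ball_mem_nhds τ hr] with w hw
    exact (integrableOn_Eich_integrand_of_decay hf hC hc hdecay n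
      (hr.trans_le (him w hw))).aestronglyMeasurable
  · filter_upwards [ae_restrict_mem measurableSet_Ioi] with s hs w hw
    refine norm_Eich_integrand_le n hs (norm_deriv_le_of_decay hf hC hc hdecay hr hs ?_)
    rw [add_ofReal_mul_I_im]
    linarith [him w hw]
  · filter_upwards [ae_restrict_mem measurableSet_Ioi] with s hs w hw
    rw [Set.mem_Ioi] at hs
    have hpos : 0 < (w + (s : ℂ) * I).im := by
      rw [add_ofReal_mul_I_im]
      linarith [him w hw]
    exact (((hasDerivAt_of_im_pos hf hpos).comp_add_const w _).mul_const _).mul_const _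

theorem hasDerivAt_ray (hf : DifferentiableOn ℂ f {τ : ℂ | 0 < τ.im}) {τ : ℂ} (hτ : 0 < τ.im)
    {s : ℝ} (hs : 0 ≤ s) :
    HasDerivAt (fun s : ℝ => f (τ + (s : ℂ) * I)) (deriv f (τ + (s : ℂ) * I) * I) s := by
  have hpos : 0 < (τ + (s : ℂ) * I).im := by
    rw [add_ofReal_mul_I_im]
    linarith
  have h : HasDerivAt (fun s : ℝ => τ + (s : ℂ) * I) I s := by
    simpa using ((hasDerivAt_id s).ofReal_comp.mul_const I).const_add τ
  exact (hasDerivAt_of_im_pos hf hpos).comp s h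

theorem Eich_zero_deriv (hf : DifferentiableOn ℂ f {τ : ℂ | 0 < τ.im})
    (hC : 0 < C) (hc : 0 < c) (hdecay : ∀ τ : ℂ, 0 < τ.im → ‖f τ‖ ≤ C * Real.exp (-c * τ.im))
    {τ : ℂ} (hτ : 0 < τ.im) : Eich 0 (deriv f) τ = -f τ := by
  have hderiv : ∀ s ∈ Set.Ici (0 : ℝ), HasDerivAt (fun s : ℝ => f (τ + (s : ℂ) * I))
      (deriv f (τ + (s : ℂ) * I) * ((s : ℂ) * I) ^ 0 * I) s := fun s hs => by
    simpa using hasDerivAt_ray hf hτ hs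
  have hint := integrableOn_Eich_integrand_deriv hf hC hc hdecay 0 hτ
  have hint' : IntegrableOn (fun s : ℝ => f (τ + (s : ℂ) * I)) (Set.Ioi 0) := by
    simpa [mul_assoc, IntegrableOn] using
      (integrableOn_Eich_integrand_of_decay hf hC hc hdecay 0 hτ).mul_const (-I)
  have hlim := tendsto_zero_of_hasDerivAt_of_integrableOn_Ioi
    (fun s hs => hderiv s (Set.Ioi_subset_Ici_self hs)) hint hint'
  simpa [Eich] using integral_Ioi_of_hasDerivAt_of_tendsto' hderiv hint hlim

/-- Integration by parts along the vertical ray. -/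
theorem Eich_succ_deriv (hf : DifferentiableOn ℂ f {τ : ℂ | 0 < τ.im})
    (hC : 0 < C) (hc : 0 < c) (hdecay : ∀ τ : ℂ, 0 < τ.im → ‖f τ‖ ≤ C * Real.exp (-c * τ.im))
    (n : ℕ) {τ : ℂ} (hτ : 0 < τ.im) :
    Eich (n + 1) (deriv f) τ = -((n : ℂ) + 1) * Eich n f τ := by
  have hderiv : ∀ s ∈ Set.Ici (0 : ℝ),
      HasDerivAt (fun s : ℝ => f (τ + (s : ℂ) * I) * ((s : ℂ) * I) ^ (n + 1))
      (deriv f (τ + (s : ℂ) * I) * ((s : ℂ) * I) ^ (n + 1) * I +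
        ((n : ℂ) + 1) * (f (τ + (s : ℂ) * I) * ((s : ℂ) * I) ^ n * I)) s := fun s hs => by
    have h : HasDerivAt (fun s : ℝ => (s : ℂ) * I) I s := by
      simpa using (hasDerivAt_id s).ofReal_comp.mul_const I
    refine ((hasDerivAt_ray hf hτ hs).mul (h.fun_pow (n + 1))).congr_deriv ?_
    push_cast [add_tsub_cancel_right]
    ring
  have hint1 := integrableOn_Eich_integrand_deriv hf hC hc hdecay (n + 1) hτ
  have hint2 := (integrableOn_Eich_integrand_of_decay hf hC hc hdecay n hτ).const_mul
    ((n : ℂ) + 1)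
  have hint' : IntegrableOn (fun s : ℝ => f (τ + (s : ℂ) * I) * ((s : ℂ) * I) ^ (n + 1))
      (Set.Ioi 0) := by
    simpa [mul_assoc, IntegrableOn] using
      (integrableOn_Eich_integrand_of_decay hf hC hc hdecay (n + 1) hτ).mul_const (-I)
  have hlim := tendsto_zero_of_hasDerivAt_of_integrableOn_Ioi
    (fun s hs => hderiv s (Set.Ioi_subset_Ici_self hs)) (hint1.add hint2) hint'
  have key := integral_Ioi_of_hasDerivAt_of_tendsto' hderiv (hint1.add hint2) hlim
  rw [integral_add hint1 hint2, integral_const_mul] at key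
  simp only [ofReal_zero, zero_mul, ne_eq, Nat.succ_ne_zero, not_false_eq_true, zero_pow,
    mul_zero, sub_zero] at key
  rw [neg_mul]
  exact eq_neg_of_add_eq_zero_left key

theorem wderOp_iterate_Eich (hf : DifferentiableOn ℂ f {τ : ℂ | 0 < τ.im})
    (hC : 0 < C) (hc : 0 < c) (hdecay : ∀ τ : ℂ, 0 < τ.im → ‖f τ‖ ≤ C * Real.exp (-c * τ.im))
    (k m : ℕ) {τ : ℂ} (hτ : 0 < τ.im) :
    wderOp^[k] (Eich (m + k) f) τ =
      (-1) ^ k * ((m + k).factorial / m.factorial : ℂ) * Eich m f τ := by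
  induction k generalizing m τ with
  | zero => simp [Nat.cast_ne_zero.2 m.factorial_ne_zero]
  | succ k ih =>
    have hloc : wderOp^[k] (Eich (m + (k + 1)) f) =ᶠ[nhds τ]
        ((-1) ^ k * ((m + 1 + k).factorial / (m + 1).factorial : ℂ)) • Eich (m + 1) f := by
      filter_upwards [(isOpen_lt continuous_const continuous_im).mem_nhds hτ] with w hw
      rw [show m + (k + 1) = m + 1 + k by ring]
      exact ih (m + 1) hw
    rw [Function.iterate_succ_apply', wderOp_congr hloc, wderOp_const_smul, Pi.smul_apply,
      (hasDerivAt_Eich hf hC hc hdecay (m + 1) hτ).wderOp_eq,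
      Eich_succ_deriv hf hC hc hdecay m hτ, smul_eq_mul, show m + (k + 1) = m + 1 + k by ring,
      Nat.factorial_succ m]
    have h1 : (m.factorial : ℂ) ≠ 0 := Nat.cast_ne_zero.2 m.factorial_ne_zero
    have h2 : (m : ℂ) + 1 ≠ 0 := Nat.cast_add_one_ne_zero m
    push_cast
    field_simp
    ring

end Decay

/-- for `f` holomorphic on `ℍ` with exponential decay, the
holomorphic Eichler integral `E_n(f)` is holomorphic on `ℍ` and satisfies the
Bol-type identity `∂_τ^{n+1} E_n(f) = (−1)^{n+1} n! f`, equivalently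
`D^{n+1}(E_n(f)) = ((−1)^{n+1} n!/(2πi)^{n+1}) f`. -/
theorem Eich_bol_identity (n : ℕ) (f : ℂ → ℂ)
    (hf : DifferentiableOn ℂ f {τ : ℂ | 0 < τ.im})
    (hdecay : ∃ C c : ℝ, 0 < C ∧ 0 < c ∧
      ∀ τ : ℂ, 0 < τ.im → ‖f τ‖ ≤ C * Real.exp (-c * τ.im)) :
    DifferentiableOn ℂ (Eich n f) {τ : ℂ | 0 < τ.im} ∧
    ∀ τ : ℂ, 0 < τ.im →
      wderOp^[n + 1] (Eich n f) τ = (-1) ^ (n + 1) * (n.factorial : ℂ) * f τ ∧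
      Dop^[n + 1] (Eich n f) τ =
        ((-1) ^ (n + 1) * (n.factorial : ℂ) / (2 * (Real.pi : ℂ) * Complex.I) ^ (n + 1)) *
          f τ := by
  obtain ⟨C, c, hC, hc, hdecay⟩ := hdecay
  have hbol : ∀ τ : ℂ, 0 < τ.im →
      wderOp^[n + 1] (Eich n f) τ = (-1) ^ (n + 1) * (n.factorial : ℂ) * f τ := by
    intro τ hτ
    have hloc : wderOp^[n] (Eich n f) =ᶠ[nhds τ]
        ((-1) ^ n * (n.factorial : ℂ)) • Eich 0 f := by
      filter_upwards [(isOpen_lt continuous_const continuous_im).mem_nhds hτ] with w hw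
      simpa using wderOp_iterate_Eich hf hC hc hdecay n 0 hw
    rw [Function.iterate_succ_apply', wderOp_congr hloc, wderOp_const_smul, Pi.smul_apply,
      (hasDerivAt_Eich hf hC hc hdecay 0 hτ).wderOp_eq, Eich_zero_deriv hf hC hc hdecay hτ,
      smul_eq_mul]
    ring
  refine ⟨fun τ hτ =>
    (hasDerivAt_Eich hf hC hc hdecay n hτ).differentiableAt.differentiableWithinAt,
    fun τ hτ => ⟨hbol τ hτ, ?_⟩⟩
  rw [Dop_iterate, Pi.smul_apply, hbol τ hτ, smul_eq_mul]
  ring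
end
end
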